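/- Let G be a unicyclic graph and let S be a biactive branch-resolving set in G, with the cycle C canonically labelled with respect to S. If G contains configuration A, configuration D, or configuration E with respect to S, then S is not an edge metric generator of G. -/

import Mathlib

open SimpleGraph

section Defs

variable {V : Type*}

/-- Distance from a vertex `s` to an edge `e`: the minimum of the distances to its endpoints. -/
noncomputable def edgeDist (G : SimpleGraph V) (s : V) (e : Sym2 V) : ℕ :=
  Sym2.lift ⟨fun u w => min (G.dist s u) (G.dist s w), fun u w => min_comm _ _⟩ e

/-- `S` is a vertex metric generator of `G`. -/
def IsVertexMG (G : SimpleGraph V) (S : Set V) : Prop :=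
  ∀ u v : V, u ≠ v → ∃ s ∈ S, G.dist s u ≠ G.dist s v

/-- `S` is an edge metric generator of `G`. -/
def IsEdgeMG (G : SimpleGraph V) (S : Set V) : Prop :=
  ∀ e ∈ G.edgeSet, ∀ f ∈ G.edgeSet, e ≠ f → ∃ s ∈ S, edgeDist G s e ≠ edgeDist G s f

/-- The vertex metric dimension of `G`. -/
noncomputable def metricDim (G : SimpleGraph V) : ℕ :=
  sInf {n | ∃ S : Finset V, S.card = n ∧ IsVertexMG G ↑S}

/-- The edge metric dimension of `G`. -/
noncomputable def edgeMetricDim (G : SimpleGraph V) : ℕ :=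
  sInf {n | ∃ S : Finset V, S.card = n ∧ IsEdgeMG G ↑S}

/-- `G` is unicyclic: connected, contains a cycle, and any two cycles have the same edges. -/
def IsUnicyclic (G : SimpleGraph V) : Prop :=
  G.Connected ∧ (∃ (u : V) (w : G.Walk u u), w.IsCycle) ∧
    ∀ (u u' : V) (w : G.Walk u u) (w' : G.Walk u' u'), w.IsCycle → w'.IsCycle →
      ∀ e, e ∈ w.edges ↔ e ∈ w'.edges

/-- `vc : ZMod g → V` is a labelling `v_0 v_1 ⋯ v_{g-1}` of a cycle of length `g` in `G`. -/
def IsCycleLabelling (G : SimpleGraph V) (g : ℕ) (vc : ZMod g → V) : Prop :=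
  Function.Injective vc ∧ ∀ i : ZMod g, G.Adj (vc i) (vc (i + 1))

/-- The set of edges of the cycle `C`. -/
def cycleEdges (g : ℕ) (vc : ZMod g → V) : Set (Sym2 V) :=
  {e | ∃ i : ZMod g, e = s(vc i, vc (i + 1))}

/-- The graph `G - E(C)`. -/
def offCycle (G : SimpleGraph V) (g : ℕ) (vc : ZMod g → V) : SimpleGraph V :=
  G.deleteEdges (cycleEdges g vc)

/-- `x` belongs to `T_{v_i}`, the connected component of `G - E(C)` containing `v_i`. -/
def inTree (G : SimpleGraph V) (g : ℕ) (vc : ZMod g → V) (i : ZMod g) (x : V) : Prop :=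
  (offCycle G g vc).Reachable (vc i) x

/-- The vertex `v_i` of the cycle is `S`-active: `T_{v_i}` contains a vertex of `S`. -/
def SActive (G : SimpleGraph V) (g : ℕ) (vc : ZMod g → V) (S : Set V) (i : ZMod g) : Prop :=
  ∃ s ∈ S, inTree G g vc i s

/-- `a_S(C)`: the number of `S`-active vertices on the cycle. -/
noncomputable def aS (G : SimpleGraph V) (g : ℕ) (vc : ZMod g → V) (S : Set V) : ℕ :=
  {i : ZMod g | SActive G g vc S i}.ncard

/-- `S` is biactive: `a_S(C) ≥ 2`. -/
def Biactive (G : SimpleGraph V) (g : ℕ) (vc : ZMod g → V) (S : Set V) : Prop :=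
  2 ≤ aS G g vc S

variable [Fintype V] [DecidableEq V]

/-- `t = u_1 u_2 ⋯ u_k` is a thread hanging at the vertex `v`. -/
def IsThreadAt (G : SimpleGraph V) [DecidableRel G.Adj] (v : V) (t : List V) : Prop :=
  t ≠ [] ∧ t.Nodup ∧ v ∉ t ∧ 3 ≤ G.degree v ∧ List.Chain' G.Adj t ∧
    (∀ u ∈ t.head?, G.Adj v u) ∧ (∀ u ∈ t.getLast?, G.degree u = 1) ∧
    ∀ u ∈ t.dropLast, G.degree u = 2

/-- The thread `t` is `S`-free: it contains no vertex of `S`. -/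
def SFree (S : Set V) (t : List V) : Prop := ∀ u ∈ t, u ∉ S

/-- `S` is branch-resolving: for every vertex, all threads hanging at it except possibly
one contain a vertex of `S` (i.e. at most one thread at each vertex is `S`-free). -/
def BranchResolving (G : SimpleGraph V) [DecidableRel G.Adj] (S : Set V) : Prop :=
  ∀ v : V, ∀ t₁ t₂ : List V, IsThreadAt G v t₁ → IsThreadAt G v t₂ → t₁ ≠ t₂ →
    (∃ s ∈ S, s ∈ t₁) ∨ (∃ s ∈ S, s ∈ t₂)

/-- `ℓ(v)`: the number of threads hanging at `v`. -/
noncomputable def numThreads (G : SimpleGraph V) [DecidableRel G.Adj] (v : V) : ℕ :=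
  {t : List V | IsThreadAt G v t}.ncard

/-- `L(G) = Σ (ℓ(v) - 1)` (truncated subtraction makes the sum run exactly over the
vertices with `ℓ(v) > 1`). -/
noncomputable def LG (G : SimpleGraph V) [DecidableRel G.Adj] : ℕ :=
  ∑ v : V, (numThreads G v - 1)

/-- `x` is a branching vertex of the unicyclic graph with cycle `vc`. -/
def Branching (G : SimpleGraph V) [DecidableRel G.Adj] (g : ℕ) (vc : ZMod g → V) (x : V) :
    Prop :=
  (x ∉ Set.range vc ∧ 3 ≤ G.degree x) ∨ (x ∈ Set.range vc ∧ 4 ≤ G.degree x)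

/-- The cycle vertex `v_i` is branch-active: `T_{v_i}` contains a branching vertex. -/
def BranchActive (G : SimpleGraph V) [DecidableRel G.Adj] (g : ℕ) (vc : ZMod g → V)
    (i : ZMod g) : Prop :=
  ∃ x, inTree G g vc i x ∧ Branching G g vc x

/-- `b(G)`: the number of branch-active vertices on the cycle. -/
noncomputable def bG (G : SimpleGraph V) [DecidableRel G.Adj] (g : ℕ) (vc : ZMod g → V) : ℕ :=
  {i : ZMod g | BranchActive G g vc i}.ncard

/-- `k = max { i : v_i is S-active }` for the labelling `vc` (indices taken in `[0, g-1]`). -/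
noncomputable def kOf (G : SimpleGraph V) (g : ℕ) (vc : ZMod g → V) (S : Set V) : ℕ :=
  sSup {n : ℕ | n < g ∧ SActive G g vc S (n : ZMod g)}

/-- The labelling `vc` of the cycle is canonical with respect to `S`: `v_0` is `S`-active
and `k` is as small as possible among all labellings of the cycle with `v_0` `S`-active. -/
def Canonical (G : SimpleGraph V) (g : ℕ) (vc : ZMod g → V) (S : Set V) : Prop :=
  IsCycleLabelling G g vc ∧ SActive G g vc S 0 ∧
    ∀ vc' : ZMod g → V, IsCycleLabelling G g vc' → Set.range vc' = Set.range vc →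
      SActive G g vc' S 0 → kOf G g vc S ≤ kOf G g vc' S

/-- Configuration 𝒜 : `a_S(C) = 2`, `g` even and `k = g/2`. -/
def ConfigA (G : SimpleGraph V) (g : ℕ) (vc : ZMod g → V) (S : Set V) : Prop :=
  aS G g vc S = 2 ∧ Even g ∧ kOf G g vc S = g / 2

/-- Configuration ℬ : `k ≤ ⌊g/2⌋ - 1` and an `S`-free thread hangs at `v_i` for some
`i ∈ [k, ⌊g/2⌋-1] ∪ [⌈g/2⌉+k+1, g-1] ∪ {0}`. -/
def ConfigB (G : SimpleGraph V) [DecidableRel G.Adj] (g : ℕ) (vc : ZMod g → V) (S : Set V) :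
    Prop :=
  kOf G g vc S ≤ g / 2 - 1 ∧
    ∃ i : ℕ, ((kOf G g vc S ≤ i ∧ i ≤ g / 2 - 1) ∨
        ((g + 1) / 2 + kOf G g vc S + 1 ≤ i ∧ i ≤ g - 1) ∨ i = 0) ∧
      ∃ t : List V, IsThreadAt G (vc (i : ZMod g)) t ∧ SFree S t

/-- Configuration 𝒞 : `a_S(C) = 2`, `g` even, `k ≤ g/2` and an `S`-free thread of length
`≥ g/2 - k` hangs at `v_i` for some `i ∈ [0, k]`. -/
def ConfigC (G : SimpleGraph V) [DecidableRel G.Adj] (g : ℕ) (vc : ZMod g → V) (S : Set V) :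
    Prop :=
  aS G g vc S = 2 ∧ Even g ∧ kOf G g vc S ≤ g / 2 ∧
    ∃ i : ℕ, i ≤ kOf G g vc S ∧
      ∃ t : List V, IsThreadAt G (vc (i : ZMod g)) t ∧ SFree S t ∧
        g / 2 - kOf G g vc S ≤ t.length

/-- Configuration 𝒟 : `k ≤ ⌈g/2⌉ - 1` and an `S`-free thread hangs at `v_i` for some
`i ∈ [k, ⌈g/2⌉-1] ∪ [⌊g/2⌋+k+1, g-1] ∪ {0}`. -/
def ConfigD (G : SimpleGraph V) [DecidableRel G.Adj] (g : ℕ) (vc : ZMod g → V) (S : Set V) :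
    Prop :=
  kOf G g vc S ≤ (g + 1) / 2 - 1 ∧
    ∃ i : ℕ, ((kOf G g vc S ≤ i ∧ i ≤ (g + 1) / 2 - 1) ∨
        (g / 2 + kOf G g vc S + 1 ≤ i ∧ i ≤ g - 1) ∨ i = 0) ∧
      ∃ t : List V, IsThreadAt G (vc (i : ZMod g)) t ∧ SFree S t

/-- Configuration ℰ : `a_S(C) = 2` and an `S`-free thread of length `≥ ⌊g/2⌋ - k + 1`
hangs at `v_i` with `i ∈ [0, k]`; moreover if `g` is even an `S`-free thread hangs at
`v_j` with `j = g/2 + k - i`. -/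
def ConfigE (G : SimpleGraph V) [DecidableRel G.Adj] (g : ℕ) (vc : ZMod g → V) (S : Set V) :
    Prop :=
  aS G g vc S = 2 ∧
    ∃ i : ℕ, i ≤ kOf G g vc S ∧
      (∃ t : List V, IsThreadAt G (vc (i : ZMod g)) t ∧ SFree S t ∧
        g / 2 - kOf G g vc S + 1 ≤ t.length) ∧
      (Even g → ∃ t' : List V,
        IsThreadAt G (vc ((g / 2 + kOf G g vc S - i : ℕ) : ZMod g)) t' ∧ SFree S t')

/-- `G` contains configuration 𝒜 with respect to `S` (evaluated on a canonical labelling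
of the cycle given by `vc`). -/
def ContainsA (G : SimpleGraph V) (g : ℕ) (vc : ZMod g → V) (S : Set V) : Prop :=
  ∃ vc' : ZMod g → V, IsCycleLabelling G g vc' ∧ Set.range vc' = Set.range vc ∧
    Canonical G g vc' S ∧ ConfigA G g vc' S

/-- `G` contains configuration ℬ with respect to `S`. -/
def ContainsB (G : SimpleGraph V) [DecidableRel G.Adj] (g : ℕ) (vc : ZMod g → V)
    (S : Set V) : Prop :=
  ∃ vc' : ZMod g → V, IsCycleLabelling G g vc' ∧ Set.range vc' = Set.range vc ∧
    Canonical G g vc' S ∧ ConfigB G g vc' S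

/-- `G` contains configuration 𝒞 with respect to `S`. -/
def ContainsC (G : SimpleGraph V) [DecidableRel G.Adj] (g : ℕ) (vc : ZMod g → V)
    (S : Set V) : Prop :=
  ∃ vc' : ZMod g → V, IsCycleLabelling G g vc' ∧ Set.range vc' = Set.range vc ∧
    Canonical G g vc' S ∧ ConfigC G g vc' S

/-- `G` contains configuration 𝒟 with respect to `S`. -/
def ContainsD (G : SimpleGraph V) [DecidableRel G.Adj] (g : ℕ) (vc : ZMod g → V)
    (S : Set V) : Prop :=
  ∃ vc' : ZMod g → V, IsCycleLabelling G g vc' ∧ Set.range vc' = Set.range vc ∧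
    Canonical G g vc' S ∧ ConfigD G g vc' S

/-- `G` contains configuration ℰ with respect to `S`. -/
def ContainsE (G : SimpleGraph V) [DecidableRel G.Adj] (g : ℕ) (vc : ZMod g → V)
    (S : Set V) : Prop :=
  ∃ vc' : ZMod g → V, IsCycleLabelling G g vc' ∧ Set.range vc' = Set.range vc ∧
    Canonical G g vc' S ∧ ConfigE G g vc' S

/-- `G` contains one of the configurations 𝒜, ℬ, 𝒞 with respect to `S`. -/
def ContainsABC (G : SimpleGraph V) [DecidableRel G.Adj] (g : ℕ) (vc : ZMod g → V)
    (S : Set V) : Prop :=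
  ContainsA G g vc S ∨ ContainsB G g vc S ∨ ContainsC G g vc S

/-- `G` contains one of the configurations 𝒜, 𝒟, ℰ with respect to `S`. -/
def ContainsADE (G : SimpleGraph V) [DecidableRel G.Adj] (g : ℕ) (vc : ZMod g → V)
    (S : Set V) : Prop :=
  ContainsA G g vc S ∨ ContainsD G g vc S ∨ ContainsE G g vc S

/-- `S` is a smallest branch-resolving set of `G`. -/
def SmallestBR (G : SimpleGraph V) [DecidableRel G.Adj] (S : Finset V) : Prop :=
  BranchResolving G ↑S ∧ ∀ S' : Finset V, BranchResolving G ↑S' → S.card ≤ S'.card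

/-- `S` is a smallest biactive branch-resolving set of `G`. -/
def SmallestBBR (G : SimpleGraph V) [DecidableRel G.Adj] (g : ℕ) (vc : ZMod g → V)
    (S : Finset V) : Prop :=
  BranchResolving G ↑S ∧ Biactive G g vc ↑S ∧
    ∀ S' : Finset V, BranchResolving G ↑S' → Biactive G g vc ↑S' → S.card ≤ S'.card

/-- `G` is 𝒜ℬ𝒞-negative. -/
def ABCneg (G : SimpleGraph V) [DecidableRel G.Adj] (g : ℕ) (vc : ZMod g → V) : Prop :=
  ∃ S : Finset V, SmallestBBR G g vc S ∧ ¬ ContainsABC G g vc ↑S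

/-- `G` is 𝒜𝒟ℰ-negative. -/
def ADEneg (G : SimpleGraph V) [DecidableRel G.Adj] (g : ℕ) (vc : ZMod g → V) : Prop :=
  ∃ S : Finset V, SmallestBBR G g vc S ∧ ¬ ContainsADE G g vc ↑S

end Defs

theorem le_add_dist_of_adj {V : Type*} {G : SimpleGraph V} (hG : G.Connected) (f : V → ℕ)
    (hf : ∀ x y, G.Adj x y → f y ≤ f x + 1) (x y : V) : f y ≤ f x + G.dist x y := by
  obtain ⟨w, hw⟩ := hG.exists_walk_length_eq_dist x y
  rw [← hw]
  clear hw
  induction w with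
  | nil => simp
  | cons h w ih =>
    have := hf _ _ h
    rw [Walk.length_cons]
    omega

/-- The distance from `0` to `z` along a cycle of length `g`. -/
def cycDist (g : ℕ) (z : ZMod g) : ℕ := min z.val (g - z.val)

theorem cycDist_zero (g : ℕ) : cycDist g 0 = 0 := by simp [cycDist]

theorem cycDist_neg {g : ℕ} [NeZero g] (z : ZMod g) : cycDist g (-z) = cycDist g z := by
  have hz := z.val_lt
  by_cases h : z = 0
  · simp [h]
  · simp only [cycDist, ZMod.neg_val, h, if_false]
    omega

theorem cycDist_add_one_le {g : ℕ} [NeZero g] (z : ZMod g) :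
    cycDist g (z + 1) ≤ cycDist g z + 1 := by
  have hz := z.val_lt
  rcases eq_or_ne (z + 1) 0 with h | h
  · simp [h, cycDist_zero]
  · have h1 : (z + 1).val = z.val + 1 := by
      have hlt : z.val + 1 < g := by
        by_contra hc
        apply h
        have : z.val + 1 = g := by omega
        have h2 : ((z.val + 1 : ℕ) : ZMod g) = 0 := by rw [this]; simp
        simpa using h2
      have h3 : z + 1 = ((z.val + 1 : ℕ) : ZMod g) := by simp
      rw [h3, ZMod.val_natCast_of_lt hlt]
    simp only [cycDist, h1]
    omega

theorem cycDist_le_add_one {g : ℕ} [NeZero g] (z : ZMod g) :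
    cycDist g z ≤ cycDist g (z + 1) + 1 := by
  have h := cycDist_add_one_le (-(z + 1))
  rwa [cycDist_neg, show -(z + 1) + 1 = -z by ring, cycDist_neg] at h

theorem cycDist_natCast_sub {g : ℕ} [NeZero g] {a j : ℕ} (h1 : j ≤ a) (h2 : a ≤ j + g) :
    cycDist g ((a : ZMod g) - j) = min (a - j) (g - (a - j)) := by
  rw [← Nat.cast_sub h1]
  rcases (show a - j ≤ g by omega).lt_or_eq with h | h
  · simp [cycDist, ZMod.val_natCast_of_lt h]
  · simp [h, cycDist]

section Cycle

variable {V : Type*} {G : SimpleGraph V} {g : ℕ} {vc : ZMod g → V}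

theorem IsCycleLabelling.succ_ne_pred (hg : 3 ≤ g) (hvc : IsCycleLabelling G g vc)
    (m : ZMod g) : vc (m + 1) ≠ vc (m - 1) := by
  intro h
  have h2 : ((2 : ℕ) : ZMod g) = 0 := by
    push_cast
    linear_combination hvc.1 h
  rw [ZMod.natCast_eq_zero_iff] at h2
  exact absurd (Nat.le_of_dvd (by norm_num) h2) (by omega)

theorem IsCycleLabelling.edge_injective (hg : 3 ≤ g) (hvc : IsCycleLabelling G g vc)
    {a b : ZMod g} (h : s(vc a, vc (a + 1)) = s(vc b, vc (b + 1))) : a = b := by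
  rw [Sym2.eq_iff] at h
  rcases h with ⟨h, -⟩ | ⟨h, h'⟩
  · exact hvc.1 h
  · have h1 := hvc.1 h
    refine absurd ?_ (hvc.succ_ne_pred hg a)
    rw [h', h1, add_sub_cancel_right]

theorem IsCycleLabelling.reachable_add (hvc : IsCycleLabelling G g vc) (X : Set (Sym2 V))
    (a : ZMod g) (n : ℕ)
    (h : ∀ t < n, s(vc (a + t), vc (a + t + 1)) ∉ X) :
    (G.deleteEdges X).Reachable (vc a) (vc (a + n)) := by
  induction n with
  | zero => simp
  | succ n ih =>
    refine (ih fun t ht => h t (by omega)).trans ?_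
    have : (G.deleteEdges X).Adj (vc (a + n)) (vc (a + n + 1)) := by
      rw [deleteEdges_adj]
      exact ⟨hvc.2 _, h n (by omega)⟩
    simpa [add_assoc] using this.reachable

theorem IsCycleLabelling.mem_edges_of_isCycle (hg : 3 ≤ g) (hG : IsUnicyclic G)
    (hvc : IsCycleLabelling G g vc) (j : ZMod g) {u : V} (w : G.Walk u u) (hw : w.IsCycle) :
    s(vc j, vc (j + 1)) ∈ w.edges := by
  have : NeZero g := ⟨by omega⟩
  have hr : (G.deleteEdges {s(vc j, vc (j + 1))}).Reachable (vc (j + 1))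
      (vc (j + 1 + (g - 1 : ℕ))) := by
    refine hvc.reachable_add _ _ _ fun t ht hm => ?_
    have h1 := hvc.edge_injective hg (Set.mem_singleton_iff.1 hm)
    have h2 : ((t + 1 : ℕ) : ZMod g) = 0 := by
      push_cast
      linear_combination h1
    rw [ZMod.natCast_eq_zero_iff] at h2
    exact absurd (Nat.le_of_dvd (by omega) h2) (by omega)
  have h0 : j + 1 + ((g - 1 : ℕ) : ZMod g) = j := by
    rw [Nat.cast_sub (by omega)]
    simp
  rw [h0] at hr
  obtain ⟨u', w', hw', he⟩ :=
    adj_and_reachable_delete_edges_iff_exists_cycle.1 ⟨hvc.2 j, hr.symm⟩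
  exact (hG.2.2 _ _ w w' hw hw' _).2 he

theorem IsCycleLabelling.inTree_injective (hg : 3 ≤ g) (hG : IsUnicyclic G)
    (hvc : IsCycleLabelling G g vc) {i j : ZMod g} (h : inTree G g vc i (vc j)) : i = j := by
  have : NeZero g := ⟨by omega⟩
  by_contra hij
  set f : Sym2 V := s(vc j, vc (j + 1)) with hf
  set e : Sym2 V := s(vc i, vc (i + 1)) with he
  have hfe : f ≠ e := fun h => hij (hvc.edge_injective hg h).symm
  have hadj : (G.deleteEdges {f}).Adj (vc i) (vc (i + 1)) := by
    rw [deleteEdges_adj]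
    exact ⟨hvc.2 i, fun h => hfe (Set.mem_singleton_iff.1 h).symm⟩
  have hsub : (G.deleteEdges {f}).deleteEdges {e} = G.deleteEdges {f, e} := by
    rw [deleteEdges_deleteEdges, Set.insert_eq]
  have hr1 : (G.deleteEdges {f, e}).Reachable (vc i) (vc j) := by
    refine Reachable.mono (deleteEdges_anti ?_) h
    rintro x (rfl | rfl)
    · exact ⟨j, rfl⟩
    · exact ⟨i, rfl⟩
  have hlt := (j - (i + 1)).val_lt
  have hne : j - (i + 1) ≠ -1 := fun h => hij (by linear_combination -h)
  have hr2 : (G.deleteEdges {f, e}).Reachable (vc (i + 1))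
      (vc (i + 1 + ((j - (i + 1)).val : ℕ))) := by
    refine hvc.reachable_add _ _ _ fun t ht hm => ?_
    have htv : ((t : ℕ) : ZMod g).val = t := ZMod.val_natCast_of_lt (by omega)
    rcases hm with hm | hm
    · have h1 := hvc.edge_injective hg hm
      have h2 : ((t : ℕ) : ZMod g) = j - (i + 1) := by linear_combination h1
      rw [h2] at htv
      omega
    · have h1 := hvc.edge_injective hg (Set.mem_singleton_iff.1 hm)
      have h2 : ((t + 1 : ℕ) : ZMod g) = 0 := by
        push_cast
        linear_combination h1
      rw [ZMod.natCast_eq_zero_iff] at h2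
      exact absurd (Nat.le_of_dvd (by omega) h2) (by omega)
  rw [ZMod.natCast_zmod_val, add_sub_cancel] at hr2
  rw [← hsub] at hr1 hr2
  obtain ⟨u, w, hw, -⟩ :=
    adj_and_reachable_delete_edges_iff_exists_cycle.1 ⟨hadj, hr1.trans hr2.symm⟩
  have hle : G.deleteEdges {f} ≤ G := deleteEdges_le _
  have hm := hvc.mem_edges_of_isCycle hg hG j (w.mapLe hle) (hw.mapLe hle)
  rw [Walk.edges_mapLe_eq_edges] at hm
  have := w.edges_subset_edgeSet hm
  simp [f] at this

theorem inTree.offCycle_adj {i : ZMod g} {x y : V} (h : inTree G g vc i x)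
    (hxy : (offCycle G g vc).Adj x y) : inTree G g vc i y :=
  Reachable.trans h hxy.reachable

theorem adj_offCycle_or {x y : V} (h : G.Adj x y) :
    (offCycle G g vc).Adj x y ∨
      ∃ m, (x = vc m ∧ y = vc (m + 1)) ∨ (y = vc m ∧ x = vc (m + 1)) := by
  by_cases hm : s(x, y) ∈ cycleEdges g vc
  · obtain ⟨m, hm⟩ := hm
    right
    refine ⟨m, ?_⟩
    rw [Sym2.eq_iff] at hm
    tauto
  · left
    rw [offCycle, deleteEdges_adj]
    exact ⟨h, hm⟩

theorem exists_inTree (hG : G.Connected) (x : V) : ∃ i, inTree G g vc i x := by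
  obtain ⟨w⟩ := hG (vc 0) x
  suffices H : ∀ {a b : V}, G.Walk a b → (∃ i, inTree G g vc i a) → ∃ i, inTree G g vc i b from
    H w ⟨0, Reachable.refl _⟩
  intro a b w
  induction w with
  | nil => exact id
  | cons h _ ih =>
    rintro ⟨i, hi⟩
    apply ih
    rcases adj_offCycle_or (g := g) (vc := vc) h with h | ⟨m, ⟨-, rfl⟩ | ⟨rfl, -⟩⟩
    · exact ⟨i, hi.offCycle_adj h⟩
    · exact ⟨_, Reachable.refl _⟩
    · exact ⟨_, Reachable.refl _⟩

theorem inTree_unique (hg : 3 ≤ g) (hG : IsUnicyclic G)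
    (hvc : IsCycleLabelling G g vc) {i j : ZMod g} {x : V} (hi : inTree G g vc i x)
    (hj : inTree G g vc j x) : i = j :=
  hvc.inTree_injective hg hG (Reachable.trans hi hj.symm)

theorem IsCycleLabelling.dist_add_le (hG : G.Connected) (hvc : IsCycleLabelling G g vc)
    (i : ZMod g) (n : ℕ) : G.dist (vc i) (vc (i + n)) ≤ n := by
  induction n with
  | zero => simp
  | succ n ih =>
    have h1 := hG.dist_triangle (u := vc i) (v := vc (i + n)) (w := vc (i + n + 1))
    have h2 := dist_eq_one_iff_adj.2 (hvc.2 (i + n))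
    push_cast
    rw [← add_assoc]
    omega

theorem IsCycleLabelling.dist_le_cycDist [NeZero g] (hG : G.Connected)
    (hvc : IsCycleLabelling G g vc) (i j : ZMod g) :
    G.dist (vc j) (vc i) ≤ cycDist g (i - j) := by
  have h1 := hvc.dist_add_le hG j (i - j).val
  have h2 := hvc.dist_add_le hG i (g - (i - j).val)
  rw [Nat.cast_sub (i - j).val_lt.le, ZMod.natCast_zmod_val, ZMod.natCast_self,
    show i + (0 - (i - j)) = j by ring, dist_comm] at h2
  rw [ZMod.natCast_zmod_val, add_sub_cancel] at h1
  exact le_min h1 h2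

/-- A shortest path from a vertex of `T_{v_j}` to a cycle vertex goes through `v_j`. -/
theorem IsCycleLabelling.dist_eq_add_cycDist (hg : 3 ≤ g) (hG : IsUnicyclic G)
    (hvc : IsCycleLabelling G g vc) {j : ZMod g} {s : V} (hs : inTree G g vc j s)
    (i : ZMod g) : G.dist s (vc i) = G.dist s (vc j) + cycDist g (i - j) := by
  have : NeZero g := ⟨by omega⟩
  apply le_antisymm
  · exact hG.1.dist_triangle.trans (Nat.add_le_add_left (hvc.dist_le_cycDist hG.1 i j) _)
  choose p hp using exists_inTree (g := g) (vc := vc) hG.1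
  have hpu : ∀ {m x}, inTree G g vc m x → p x = m := fun h => inTree_unique hg hG hvc (hp _) h
  have hpc : ∀ m, p (vc m) = m := fun m => hpu (Reachable.refl _)
  let f : V → ℕ := fun y =>
    if p y = j then G.dist s y else G.dist s (vc j) + cycDist g (p y - j)
  have hfc : ∀ m, f (vc m) = G.dist s (vc j) + cycDist g (m - j) := by
    intro m
    simp only [f, hpc]
    split_ifs with h
    · simp [h, cycDist_zero]
    · rfl
  have hf : ∀ x y, G.Adj x y → f y ≤ f x + 1 := by
    intro x y hxy
    rcases adj_offCycle_or (g := g) (vc := vc) hxy with h | ⟨m, ⟨rfl, rfl⟩ | ⟨rfl, rfl⟩⟩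
    · have hpe : p y = p x := hpu ((hp x).offCycle_adj h)
      simp only [f, hpe]
      split_ifs
      · have := hG.1.dist_triangle (u := s) (v := x) (w := y)
        rwa [dist_eq_one_iff_adj.2 hxy] at this
      · omega
    · rw [hfc, hfc]
      have := cycDist_add_one_le (m - j)
      rw [sub_add_eq_add_sub] at this
      omega
    · rw [hfc, hfc]
      have := cycDist_le_add_one (m - j)
      rw [sub_add_eq_add_sub] at this
      omega
  have := le_add_dist_of_adj hG.1 f hf s (vc i)
  rw [hfc] at this
  simpa [f, hpu hs] using this

theorem IsCycleLabelling.dist_eq_of_le (hg : 3 ≤ g) (hG : IsUnicyclic G)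
    (hvc : IsCycleLabelling G g vc) {j a : ℕ} {s : V} (hs : inTree G g vc j s)
    (h1 : j ≤ a) (h2 : a ≤ j + g) :
    G.dist s (vc a) = G.dist s (vc j) + min (a - j) (g - (a - j)) := by
  have : NeZero g := ⟨by omega⟩
  rw [hvc.dist_eq_add_cycDist hg hG hs, cycDist_natCast_sub h1 h2]

theorem IsCycleLabelling.dist_eq_of_ge (hg : 3 ≤ g) (hG : IsUnicyclic G)
    (hvc : IsCycleLabelling G g vc) {j a : ℕ} {s : V} (hs : inTree G g vc j s)
    (h1 : a ≤ j) (h2 : j ≤ a + g) :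
    G.dist s (vc a) = G.dist s (vc j) + min (j - a) (g - (j - a)) := by
  have : NeZero g := ⟨by omega⟩
  rw [hvc.dist_eq_add_cycDist hg hG hs, ← cycDist_neg, neg_sub, cycDist_natCast_sub h1 h2]

end Cycle

section Thread

variable {V : Type*} [Fintype V] {G : SimpleGraph V} [DecidableRel G.Adj]
  {v : V} {t : List V}

theorem IsThreadAt.length_pos (ht : IsThreadAt G v t) : 0 < t.length :=
  List.length_pos_iff.2 ht.1

theorem IsThreadAt.nodup_cons (ht : IsThreadAt G v t) : (v :: t).Nodup :=
  List.nodup_cons.2 ⟨ht.2.2.1, ht.2.1⟩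

theorem IsThreadAt.adj (ht : IsThreadAt G v t) {n : ℕ} (hn : n < t.length) :
    G.Adj ((v :: t)[n]'(Nat.lt_succ_of_lt hn)) t[n] := by
  have hc : List.IsChain G.Adj (v :: t) :=
    List.isChain_cons.2 ⟨ht.2.2.2.2.2.1, ht.2.2.2.2.1⟩
  exact List.isChain_iff_getElem.1 hc n (Nat.succ_lt_succ hn)

theorem IsThreadAt.eq_of_adj (ht : IsThreadAt G v t) {n : ℕ} (hn : n < t.length) {y : V}
    (hy : G.Adj t[n] y) :
    y = (v :: t)[n]'(Nat.lt_succ_of_lt hn) ∨ ∃ h : n + 1 < t.length, y = t[n + 1] := by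
  classical
  have h0 := (G.mem_neighborFinset _ _).2 (ht.adj hn).symm
  have hy' := (G.mem_neighborFinset _ _).2 hy
  by_cases h : n + 1 < t.length
  · have hdeg : G.degree t[n] = 2 := by
      apply ht.2.2.2.2.2.2.2
      have hn' : n < t.dropLast.length := by
        rw [List.length_dropLast]
        omega
      rw [← List.getElem_dropLast hn']
      exact List.getElem_mem hn'
    have h1 := (G.mem_neighborFinset _ _).2 (ht.adj h)
    have hne : (v :: t)[n]'(Nat.lt_succ_of_lt hn) ≠ t[n + 1] := by
      intro he
      have : (v :: t)[n]'(Nat.lt_succ_of_lt hn) = (v :: t)[n + 2]'(Nat.succ_lt_succ h) := he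
      rw [ht.nodup_cons.getElem_inj_iff] at this
      omega
    rw [← card_neighborFinset_eq_degree, Finset.card_eq_two] at hdeg
    obtain ⟨a, b, -, hab⟩ := hdeg
    simp only [List.getElem_cons_succ] at h1
    rw [hab] at h0 h1 hy'
    simp only [Finset.mem_insert, Finset.mem_singleton] at h0 h1 hy'
    grind
  · left
    have hdeg : G.degree t[n] = 1 := by
      apply ht.2.2.2.2.2.2.1
      rw [List.getLast?_eq_getElem?, show t.length - 1 = n by omega]
      simp [hn]
    rw [← card_neighborFinset_eq_degree, Finset.card_eq_one] at hdeg
    obtain ⟨a, ha⟩ := hdeg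
    rw [ha, Finset.mem_singleton] at h0 hy'
    rw [h0, hy']

/-- Every path from a vertex outside a thread into the thread enters it at its first vertex. -/
theorem IsThreadAt.dist_getElem_cons (hG : G.Connected) (ht : IsThreadAt G v t) {s : V}
    (hs : s ∉ t) {n : ℕ} (hn : n < (v :: t).length) :
    G.dist s (v :: t)[n] = G.dist s v + n := by
  classical
  apply le_antisymm
  · induction n with
    | zero => simp
    | succ n ih =>
      have h1 := ih (by omega)
      have h2 := hG.dist_triangle (u := s) (v := (v :: t)[n]) (w := (v :: t)[n + 1])
      have h3 := dist_eq_one_iff_adj.2 (ht.adj (Nat.lt_of_succ_lt_succ hn))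
      simp only [List.getElem_cons_succ] at h2 ⊢
      omega
  let f : V → ℕ := fun y => if y ∈ t then G.dist s v + t.idxOf y + 1 else G.dist s y
  have hft : ∀ n (hn : n < (v :: t).length), f (v :: t)[n] = G.dist s v + n := by
    intro n hn
    cases n with
    | zero => simp [f, ht.2.2.1]
    | succ n =>
      have hn' := Nat.lt_of_succ_lt_succ hn
      simp [f, ht.2.1.idxOf_getElem n hn', add_assoc]
  have hf : ∀ x y, G.Adj x y → f y ≤ f x + 1 := by
    intro x y hxy
    by_cases hx : x ∈ t
    · obtain ⟨n, hn, rfl⟩ := List.getElem_of_mem hx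
      have h1 := hft (n + 1) (Nat.succ_lt_succ hn)
      rw [List.getElem_cons_succ] at h1
      rcases ht.eq_of_adj hn hxy with rfl | ⟨h, rfl⟩
      · rw [hft, h1]
        omega
      · have h2 := hft (n + 2) (Nat.succ_lt_succ h)
        rw [List.getElem_cons_succ] at h2
        omega
    · by_cases hy : y ∈ t
      · obtain ⟨n, hn, rfl⟩ := List.getElem_of_mem hy
        have h1 := hft (n + 1) (Nat.succ_lt_succ hn)
        rw [List.getElem_cons_succ] at h1
        rcases ht.eq_of_adj hn hxy.symm with rfl | ⟨h, rfl⟩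
        · rw [hft, h1]
          omega
        · exact absurd (List.getElem_mem h) hx
      · have := hG.dist_triangle (u := s) (v := x) (w := y)
        rw [dist_eq_one_iff_adj.2 hxy] at this
        simpa [f, hx, hy] using this
  have := le_add_dist_of_adj hG f hf s (v :: t)[n]
  rw [hft] at this
  simpa [f, hs] using this

theorem IsThreadAt.edgeDist_eq (hG : G.Connected) (ht : IsThreadAt G v t) {s : V}
    (hs : s ∉ t) {n : ℕ} (hn : n < t.length) :
    edgeDist G s s((v :: t)[n]'(Nat.lt_succ_of_lt hn), t[n]) = G.dist s v + n := by
  have h1 := ht.dist_getElem_cons hG hs (Nat.lt_succ_of_lt hn)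
  have h2 := ht.dist_getElem_cons hG hs (Nat.succ_lt_succ hn)
  rw [List.getElem_cons_succ] at h2
  simp only [edgeDist, Sym2.lift_mk, h1, h2]
  omega

theorem IsThreadAt.cycle_vertex_notMem {g : ℕ} {vc : ZMod g → V} (hg : 3 ≤ g)
    (hvc : IsCycleLabelling G g vc) (ht : IsThreadAt G v t) (m : ZMod g) : vc m ∉ t := by
  have hnext : ∀ n (hn : n < t.length) m, vc m = t[n] →
      ∃ h : n + 1 < t.length, ∃ m', vc m' = t[n + 1] := by
    intro n hn m hm
    have h1 := hvc.2 m
    have h2 := (hvc.2 (m - 1)).symm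
    rw [sub_add_cancel] at h2
    rw [hm] at h1 h2
    rcases ht.eq_of_adj hn h1 with h1 | ⟨h, h1⟩
    · rcases ht.eq_of_adj hn h2 with h2 | ⟨h, h2⟩
      · exact absurd (h1.trans h2.symm) (hvc.succ_ne_pred hg m)
      · exact ⟨h, _, h2⟩
    · exact ⟨h, _, h1⟩
  suffices H : ∀ k n (hn : n < t.length), n + k + 1 = t.length → ∀ m, vc m ≠ t[n] by
    intro hm
    obtain ⟨n, hn, he⟩ := List.getElem_of_mem hm
    exact H (t.length - 1 - n) n hn (by omega) m he.symm
  intro k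
  induction k with
  | zero =>
    intro n hn hk m hm
    obtain ⟨h, -⟩ := hnext n hn m hm
    omega
  | succ k ih =>
    intro n hn hk m hm
    obtain ⟨h, m', hm'⟩ := hnext n hn m hm
    exact ih (n + 1) h (by omega) m' hm'

end Thread

section Active

variable {V : Type*} {G : SimpleGraph V} {g : ℕ} {vc : ZMod g → V} {S : Set V}

theorem natCast_zmod_inj {a b : ℕ} (ha : a < g) (hb : b < g) (h : (a : ZMod g) = b) :
    a = b := by
  rwa [ZMod.natCast_eq_natCast_iff', Nat.mod_eq_of_lt ha, Nat.mod_eq_of_lt hb] at h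

theorem le_kOf {n : ℕ} (hn : n < g) (h : SActive G g vc S n) : n ≤ kOf G g vc S :=
  le_csSup ⟨g, fun _ hm => hm.1.le⟩ ⟨hn, h⟩

theorem kOf_mem (hg : 0 < g) (h0 : SActive G g vc S 0) :
    kOf G g vc S < g ∧ SActive G g vc S (kOf G g vc S : ZMod g) :=
  Nat.sSup_mem (s := {n : ℕ | n < g ∧ SActive G g vc S (n : ZMod g)})
    ⟨0, hg, by simpa using h0⟩ ⟨g, fun _ hm => hm.1.le⟩

theorem exists_inTree_natCast [NeZero g] (hG : G.Connected) {s : V} (hs : s ∈ S) :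
    ∃ j : ℕ, j < g ∧ SActive G g vc S j ∧ inTree G g vc j s := by
  obtain ⟨i, hi⟩ := exists_inTree (g := g) (vc := vc) hG s
  rw [← ZMod.natCast_zmod_val i] at hi
  exact ⟨i.val, i.val_lt, ⟨s, hs, hi⟩, hi⟩

theorem Biactive.kOf_pos [NeZero g] (hbi : Biactive G g vc S) : 0 < kOf G g vc S := by
  have hlt : 1 < {i : ZMod g | SActive G g vc S i}.ncard := hbi
  obtain ⟨i, hi, hne⟩ := Set.exists_ne_of_one_lt_ncard hlt 0
  have h1 : i.val ≤ kOf G g vc S :=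
    le_kOf i.val_lt (by rw [ZMod.natCast_zmod_val]; exact hi)
  have h2 : i.val ≠ 0 := fun h => hne ((ZMod.val_eq_zero i).1 h)
  omega

theorem eq_zero_or_eq_kOf [NeZero g] (h0 : SActive G g vc S 0) (h2 : aS G g vc S = 2)
    {n : ℕ} (hn : n < g) (h : SActive G g vc S n) : n = 0 ∨ n = kOf G g vc S := by
  have hbi : Biactive G g vc S := h2.ge
  have hg : 0 < g := NeZero.pos g
  obtain ⟨hk, hka⟩ := kOf_mem hg h0
  have hne : (0 : ZMod g) ≠ (kOf G g vc S : ZMod g) := fun he =>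
    hbi.kOf_pos.ne (natCast_zmod_inj hg hk (by simpa using he))
  have hset : ({0, (kOf G g vc S : ZMod g)} : Set (ZMod g)) = {i | SActive G g vc S i} := by
    apply Set.eq_of_subset_of_ncard_le
    · rintro x (rfl | rfl)
      exacts [h0, hka]
    · rw [Set.ncard_pair hne]
      exact h2.le
    · exact Set.toFinite _
  have hm : (n : ZMod g) ∈ ({0, (kOf G g vc S : ZMod g)} : Set (ZMod g)) := by
    rw [hset]
    exact h
  rcases hm with hm | hm
  · exact .inl (natCast_zmod_inj hn hg (by simpa using hm))
  · exact .inr (natCast_zmod_inj hn hk hm)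

theorem cycleEdges_shift (a : ZMod g) :
    cycleEdges g (fun i => vc (i + a)) = cycleEdges g vc := by
  ext e
  constructor
  · rintro ⟨i, rfl⟩
    exact ⟨i + a, by rw [add_right_comm]⟩
  · rintro ⟨i, rfl⟩
    refine ⟨i - a, ?_⟩
    simp [add_right_comm _ (1 : ZMod g) a]

theorem sActive_shift (a i : ZMod g) :
    SActive G g (fun i => vc (i + a)) S i ↔ SActive G g vc S (i + a) := by
  simp only [SActive, inTree, offCycle, cycleEdges_shift]

theorem Canonical.kOf_le_half [NeZero g] (hcan : Canonical G g vc S)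
    (h2 : aS G g vc S = 2) : kOf G g vc S ≤ g / 2 := by
  obtain ⟨hvc, h0, hmin⟩ := hcan
  have hg : 0 < g := NeZero.pos g
  obtain ⟨hk, hka⟩ := kOf_mem hg h0
  set k := kOf G g vc S with hkdef
  have hle := hmin (fun i => vc (i + k))
    ⟨fun x y h => add_right_cancel (hvc.1 h), fun i => by
      have := hvc.2 (i + k)
      rwa [add_right_comm] at this⟩
    ((Equiv.addRight (k : ZMod g)).surjective.range_comp vc)
    (by rw [sActive_shift]; simpa using hka)
  have hle' : kOf G g (fun i => vc (i + k)) S ≤ g - k := by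
    refine csSup_le' ?_
    rintro n ⟨hn, hna⟩
    rw [sActive_shift] at hna
    by_contra! hc
    have hcast : ((n : ZMod g) + k) = ((n + k - g : ℕ) : ZMod g) := by
      rw [Nat.cast_sub (by omega)]
      simp
    rw [hcast] at hna
    rcases eq_zero_or_eq_kOf h0 h2 (by omega) hna with h | h <;> omega
  omega

end Active

section Configurations

variable {V : Type*} {G : SimpleGraph V} {g : ℕ} {vc : ZMod g → V} {S : Set V}

theorem IsCycleLabelling.adj_natCast (hvc : IsCycleLabelling G g vc) (a : ℕ) :
    G.Adj (vc a) (vc (a + 1 : ℕ)) := by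
  simpa using hvc.2 a

theorem not_isEdgeMG_of_adj {a b c d : V} (h₁ : G.Adj a b) (h₂ : G.Adj c d)
    (hne : s(a, b) ≠ s(c, d)) (h : ∀ s ∈ S, edgeDist G s s(a, b) = edgeDist G s s(c, d)) :
    ¬ IsEdgeMG G S := fun hS =>
  let ⟨s, hs, hd⟩ := hS _ h₁ _ h₂ hne
  hd (h s hs)

theorem ConfigA.not_isEdgeMG (hg : 3 ≤ g) (hG : IsUnicyclic G) (hvc : IsCycleLabelling G g vc)
    (h0 : SActive G g vc S 0) (h : ConfigA G g vc S) : ¬ IsEdgeMG G S := by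
  have : NeZero g := ⟨by omega⟩
  obtain ⟨h2, heven, hk⟩ := h
  refine not_isEdgeMG_of_adj (hvc.adj_natCast (g - 1)) (hvc.adj_natCast 0) ?_ fun s hs => ?_
  · intro he
    rw [Nat.cast_succ, Nat.cast_succ] at he
    have := natCast_zmod_inj (by omega) (by omega) (hvc.edge_injective hg he)
    omega
  obtain ⟨j, hj, hja, hjs⟩ := exists_inTree_natCast (vc := vc) hG.1 hs
  have hmod := Nat.even_iff.1 heven
  simp only [edgeDist, Sym2.lift_mk]
  rcases eq_zero_or_eq_kOf h0 h2 hj hja with rfl | rfl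
  · rw [hvc.dist_eq_of_le hg hG hjs (a := g - 1) (by omega) (by omega),
      hvc.dist_eq_of_le hg hG hjs (a := g - 1 + 1) (by omega) (by omega),
      hvc.dist_eq_of_le hg hG hjs (a := 0 + 1) (by omega) (by omega)]
    omega
  · rw [hvc.dist_eq_of_le hg hG hjs (a := g - 1) (by omega) (by omega),
      hvc.dist_eq_of_le hg hG hjs (a := g - 1 + 1) (by omega) (by omega),
      hvc.dist_eq_of_ge hg hG hjs (a := 0) (by omega) (by omega),
      hvc.dist_eq_of_ge hg hG hjs (a := 0 + 1) (by omega) (by omega)]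
    omega

variable [Fintype V] [DecidableRel G.Adj]

/-- An `S`-free thread has an edge not distinguished by `S` from a cycle edge, provided that
the two edges are at equal distance from every vertex of `S`. -/
theorem IsThreadAt.not_isEdgeMG {v : V} {t : List V} (hg : 3 ≤ g) (hG : G.Connected)
    (hvc : IsCycleLabelling G g vc) (ht : IsThreadAt G v t) (hfree : SFree S t) {n : ℕ}
    (hn : n < t.length) (a : ℕ)
    (h : ∀ s ∈ S, min (G.dist s (vc a)) (G.dist s (vc (a + 1 : ℕ))) = G.dist s v + n) :
    ¬ IsEdgeMG G S := by
  have hmem := List.getElem_mem hn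
  refine not_isEdgeMG_of_adj (hvc.adj_natCast a) (ht.adj hn) ?_ fun s hs => ?_
  · intro he
    rcases Sym2.eq_iff.1 he with ⟨-, he⟩ | ⟨he, -⟩ <;>
      exact ht.cycle_vertex_notMem hg hvc _ (he ▸ hmem)
  · rw [ht.edgeDist_eq hG (fun hst => hfree s hst hs) hn, ← h s hs]
    rfl

theorem ConfigD.not_isEdgeMG (hg : 3 ≤ g) (hG : IsUnicyclic G) (hvc : IsCycleLabelling G g vc)
    (h : ConfigD G g vc S) : ¬ IsEdgeMG G S := by
  have : NeZero g := ⟨by omega⟩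
  obtain ⟨hk, i, hi, t, ht, hfree⟩ := h
  have hj : ∀ s ∈ S, ∃ j : ℕ, j < g ∧ j ≤ kOf G g vc S ∧ inTree G g vc j s := fun s hs => by
    obtain ⟨j, hj, hja, hjs⟩ := exists_inTree_natCast (vc := vc) hG.1 hs
    exact ⟨j, hj, le_kOf hj hja, hjs⟩
  rcases hi with ⟨h1, h2⟩ | ⟨h1, h2⟩ | rfl
  · refine ht.not_isEdgeMG hg hG.1 hvc hfree ht.length_pos i fun s hs => ?_
    obtain ⟨j, hj, hjk, hjs⟩ := hj s hs
    rw [hvc.dist_eq_of_le hg hG hjs (a := i) (by omega) (by omega),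
      hvc.dist_eq_of_le hg hG hjs (a := i + 1) (by omega) (by omega)]
    omega
  · refine ht.not_isEdgeMG hg hG.1 hvc hfree ht.length_pos (i - 1) fun s hs => ?_
    obtain ⟨j, hj, hjk, hjs⟩ := hj s hs
    rw [show i - 1 + 1 = i by omega,
      hvc.dist_eq_of_le hg hG hjs (a := i) (by omega) (by omega),
      hvc.dist_eq_of_le hg hG hjs (a := i - 1) (by omega) (by omega)]
    omega
  · refine ht.not_isEdgeMG hg hG.1 hvc hfree ht.length_pos (g - 1) fun s hs => ?_
    obtain ⟨j, hj, hjk, hjs⟩ := hj s hs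
    rw [hvc.dist_eq_of_ge hg hG hjs (a := 0) (by omega) (by omega),
      hvc.dist_eq_of_le hg hG hjs (a := g - 1) (by omega) (by omega),
      hvc.dist_eq_of_le hg hG hjs (a := g - 1 + 1) (by omega) (by omega)]
    omega

theorem ConfigE.not_isEdgeMG (hg : 3 ≤ g) (hG : IsUnicyclic G) (hcan : Canonical G g vc S)
    (h : ConfigE G g vc S) : ¬ IsEdgeMG G S := by
  have : NeZero g := ⟨by omega⟩
  obtain ⟨h2, i, hi, ⟨t, ht, hfree, hlen⟩, heven⟩ := h
  have hvc := hcan.1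
  have hk := hcan.kOf_le_half h2
  have hj : ∀ s ∈ S, ∃ j : ℕ, (j = 0 ∨ j = kOf G g vc S) ∧ inTree G g vc j s := fun s hs => by
    obtain ⟨j, hj, hja, hjs⟩ := exists_inTree_natCast (vc := vc) hG.1 hs
    exact ⟨j, eq_zero_or_eq_kOf hcan.2.1 h2 hj hja, hjs⟩
  rcases Nat.even_or_odd g with hg2 | hg2
  · rcases hk.eq_or_lt with hk | hk
    · exact ConfigA.not_isEdgeMG hg hG hvc hcan.2.1 ⟨h2, hg2, hk⟩
    obtain ⟨t', ht', hfree'⟩ := heven hg2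
    have hmod := Nat.even_iff.1 hg2
    refine not_isEdgeMG_of_adj (ht.adj hlen) (ht'.adj ht'.length_pos) ?_ fun s hs => ?_
    · intro he
      have hmem : vc (g / 2 + kOf G g vc S - i : ℕ) ∈ vc i :: t := by
        rcases Sym2.eq_iff.1 he with ⟨he, -⟩ | ⟨-, he⟩
        · rw [List.getElem_cons_zero] at he
          exact he ▸ List.getElem_mem _
        · rw [List.getElem_cons_zero] at he
          exact he ▸ List.mem_cons_of_mem _ (List.getElem_mem _)
      rcases List.mem_cons.1 hmem with he | he
      · have := natCast_zmod_inj (by omega) (by omega) (hvc.1 he)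
        omega
      · exact ht.cycle_vertex_notMem hg hvc _ he
    rw [ht.edgeDist_eq hG.1 (fun hst => hfree s hst hs) hlen,
      ht'.edgeDist_eq hG.1 (fun hst => hfree' s hst hs) ht'.length_pos]
    obtain ⟨j, rfl | rfl, hjs⟩ := hj s hs
    · rw [hvc.dist_eq_of_le hg hG hjs (a := i) (by omega) (by omega),
        hvc.dist_eq_of_le hg hG hjs (a := g / 2 + kOf G g vc S - i) (by omega) (by omega)]
      omega
    · rw [hvc.dist_eq_of_ge hg hG hjs (a := i) (by omega) (by omega),
        hvc.dist_eq_of_le hg hG hjs (a := g / 2 + kOf G g vc S - i) (by omega) (by omega)]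
      omega
  · have hmod := Nat.odd_iff.1 hg2
    refine ht.not_isEdgeMG hg hG.1 hvc hfree hlen (g / 2 + kOf G g vc S - i) fun s hs => ?_
    obtain ⟨j, rfl | rfl, hjs⟩ := hj s hs
    · rw [hvc.dist_eq_of_le hg hG hjs (a := i) (by omega) (by omega),
        hvc.dist_eq_of_le hg hG hjs (a := g / 2 + kOf G g vc S - i) (by omega) (by omega),
        hvc.dist_eq_of_le hg hG hjs (a := g / 2 + kOf G g vc S - i + 1) (by omega) (by omega)]
      omega
    · rw [hvc.dist_eq_of_ge hg hG hjs (a := i) (by omega) (by omega),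
        hvc.dist_eq_of_le hg hG hjs (a := g / 2 + kOf G g vc S - i) (by omega) (by omega),
        hvc.dist_eq_of_le hg hG hjs (a := g / 2 + kOf G g vc S - i + 1) (by omega) (by omega)]
      omega

end Configurations

theorem statement_7 {V : Type*} [Fintype V] [DecidableEq V] (G : SimpleGraph V)
    [DecidableRel G.Adj] (hG : IsUnicyclic G) (g : ℕ) (hg : 3 ≤ g)
    (vc : ZMod g → V) (hvc : IsCycleLabelling G g vc)
    (S : Set V) (hbr : BranchResolving G S) (hbi : Biactive G g vc S)
    (hcan : Canonical G g vc S)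
    (hconf : ConfigA G g vc S ∨ ConfigD G g vc S ∨ ConfigE G g vc S) :
    ¬ IsEdgeMG G S := by
  rcases hconf with h | h | h
  · exact h.not_isEdgeMG hg hG hvc hcan.2.1
  · exact h.not_isEdgeMG hg hG hvc
  · exact h.not_isEdgeMG hg hG hcan
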